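/- Every node expression φ∈N̂ₙ (i.e., every normal form of level n for XPath↓⁻) is satisfiable: there exists a data tree T with root r such that T,r⊨φ. -/

import Mathlib

attribute [local instance] Classical.propDecidable

mutual
/-- Path expressions of `XPath↓⁻` (no inequality tests in the language). -/
inductive PathExpr (A : Type) : Type
  | eps : PathExpr A
  | down : PathExpr A
  | test : NodeExpr A → PathExpr A
  | comp : PathExpr A → PathExpr A → PathExpr A
  | union : PathExpr A → PathExpr A → PathExpr A

/-- Node expressions of `XPath↓⁻` (no inequality tests in the language). -/
inductive NodeExpr (A : Type) : Type
  | lab : A → NodeExpr A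
  | neg : NodeExpr A → NodeExpr A
  | conj : NodeExpr A → NodeExpr A → NodeExpr A
  | diam : PathExpr A → NodeExpr A
  | eqTest : PathExpr A → PathExpr A → NodeExpr A
end

namespace XPathMinus

variable {A : Type}

/-- Defined disjunction `φ ∨ ψ := ¬(¬φ ∧ ¬ψ)`. -/
def nOr (φ ψ : NodeExpr A) : NodeExpr A := .neg (.conj (.neg φ) (.neg ψ))

/-- `⊤ := ⟨ε⟩`. -/
def topN : NodeExpr A := .diam .eps

/-- `⊥ := ¬⊤`. -/
def botN : NodeExpr A := .neg topN

/-- `⊥̄ := [¬⟨ε⟩]`. -/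
def botP : PathExpr A := .test (.neg (.diam .eps))

def bigOr (l : List (NodeExpr A)) : NodeExpr A := l.foldr nOr botN

def bigUnion (l : List (PathExpr A)) : PathExpr A := l.foldr PathExpr.union botP

/-- A data tree: a tree (connected, acyclic, unique parents except the root)
whose nodes carry labels from `A`, together with a partition of the nodes
(presented as an equivalence relation `eqd`). -/
structure DataTree (A : Type) where
  X : Type
  child : X → X → Prop
  root : X
  label : X → A
  eqd : X → X → Prop
  eqd_equiv : Equivalence eqd
  parent_unique : ∀ ⦃x y z : X⦄, child x z → child y z → x = y
  root_no_parent : ∀ x : X, ¬ child x root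
  reach : ∀ x : X, Relation.ReflTransGen child root x
  acyclic : ∀ x : X, ¬ Relation.TransGen child x x

mutual
/-- Semantics of path expressions. -/
def psem (T : DataTree A) : PathExpr A → T.X → T.X → Prop
  | .eps, x, y => x = y
  | .down, x, y => T.child x y
  | .test φ, x, y => x = y ∧ nsem T φ x
  | .comp α β, x, z => ∃ y, psem T α x y ∧ psem T β y z
  | .union α β, x, y => psem T α x y ∨ psem T β x y

/-- Semantics of node expressions. -/
def nsem (T : DataTree A) : NodeExpr A → T.X → Prop
  | .lab a, x => T.label x = a
  | .neg φ, x => ¬ nsem T φ x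
  | .conj φ ψ, x => nsem T φ x ∧ nsem T ψ x
  | .diam α, x => ∃ y, psem T α x y
  | .eqTest α β, x => ∃ y z, psem T α x y ∧ psem T β x z ∧ T.eqd y z
end

/-- Semantic equivalence of node expressions: same denotation in every data tree. -/
def nodeValid (φ ψ : NodeExpr A) : Prop :=
  ∀ (T : DataTree A) (x : T.X), nsem T φ x ↔ nsem T ψ x

/-- Semantic equivalence of path expressions: same denotation in every data tree. -/
def pathValid (α β : PathExpr A) : Prop :=
  ∀ (T : DataTree A) (x y : T.X), psem T α x y ↔ psem T β x y

mutual
/-- Derivability of node equivalences in the axiomatic system `XP⁻`. -/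
inductive NDer {A : Type} [Fintype A] : NodeExpr A → NodeExpr A → Prop
  | refl (φ : NodeExpr A) : NDer φ φ
  | symm {φ ψ : NodeExpr A} : NDer φ ψ → NDer ψ φ
  | trans {φ ψ ρ : NodeExpr A} : NDer φ ψ → NDer ψ ρ → NDer φ ρ
  | congr_neg {φ ψ : NodeExpr A} : NDer φ ψ → NDer (.neg φ) (.neg ψ)
  | congr_conj {φ φ' ψ ψ' : NodeExpr A} :
      NDer φ φ' → NDer ψ ψ' → NDer (.conj φ ψ) (.conj φ' ψ')
  | congr_diam {α β : PathExpr A} : PDer α β → NDer (.diam α) (.diam β)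
  | congr_eqTest {α α' β β' : PathExpr A} :
      PDer α α' → PDer β β' → NDer (.eqTest α β) (.eqTest α' β')
  | lbAx1 : NDer topN (bigOr ((Finset.univ : Finset A).toList.map NodeExpr.lab))
  | lbAx2 {a b : A} : a ≠ b → NDer botN (.conj (.lab a) (.lab b))
  | ndAx1 (φ ψ : NodeExpr A) :
      NDer φ (nOr (.neg (nOr (.neg φ) ψ)) (.neg (nOr (.neg φ) (.neg ψ))))
  | ndAx2 (φ : NodeExpr A) : NDer (.diam (.test φ)) φ
  | ndAx3 (α β : PathExpr A) : NDer (.diam (.union α β)) (nOr (.diam α) (.diam β))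
  | ndAx4 (α β : PathExpr A) : NDer (.diam (.comp α β)) (.diam (.comp α (.test (.diam β))))
  | eqAx1 (α β : PathExpr A) : NDer (.eqTest α β) (.eqTest β α)
  | eqAx2 (α β γ : PathExpr A) :
      NDer (.eqTest (.union α β) γ) (nOr (.eqTest α γ) (.eqTest β γ))
  | eqAx3 (φ : NodeExpr A) (α β : PathExpr A) :
      NDer (.conj φ (.eqTest α β)) (.eqTest (.comp (.test φ) α) β)
  | eqAx4 (α β : PathExpr A) : NDer (nOr (.eqTest α β) (.diam α)) (.diam α)
  | eqAx5 (γ α β : PathExpr A) :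
      NDer (nOr (.diam (.comp γ (.test (.eqTest α β)))) (.eqTest (.comp γ α) (.comp γ β)))
        (.eqTest (.comp γ α) (.comp γ β))
  | eqAx6 (α : PathExpr A) : NDer (.eqTest α α) (.diam α)
  | eqAx7 (α β : PathExpr A) :
      NDer (nOr (.conj (.eqTest α .eps) (.eqTest β .eps)) (.eqTest α β)) (.eqTest α β)
  | eqAx8 (α β γ : PathExpr A) :
      NDer (nOr (.eqTest α (.comp β (.test (.eqTest .eps γ)))) (.eqTest α (.comp β γ)))
        (.eqTest α (.comp β γ))

/-- Derivability of path equivalences in the axiomatic system `XP⁻`. -/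
inductive PDer {A : Type} [Fintype A] : PathExpr A → PathExpr A → Prop
  | refl (α : PathExpr A) : PDer α α
  | symm {α β : PathExpr A} : PDer α β → PDer β α
  | trans {α β γ : PathExpr A} : PDer α β → PDer β γ → PDer α γ
  | congr_test {φ ψ : NodeExpr A} : NDer φ ψ → PDer (.test φ) (.test ψ)
  | congr_comp {α α' β β' : PathExpr A} :
      PDer α α' → PDer β β' → PDer (.comp α β) (.comp α' β')
  | congr_union {α α' β β' : PathExpr A} :
      PDer α α' → PDer β β' → PDer (.union α β) (.union α' β')
  | prAx1 (α β : PathExpr A) : PDer (.comp (.comp α (.test (.neg (.diam β)))) β) botP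
  | prAx2 : PDer (.test topN) (.eps : PathExpr A)
  | prAx3 (φ ψ : NodeExpr A) : PDer (.test (nOr φ ψ)) (.union (.test φ) (.test ψ))
  | isAx1 (α β γ : PathExpr A) : PDer (.union (.union α β) γ) (.union α (.union β γ))
  | isAx2 (α β : PathExpr A) : PDer (.union α β) (.union β α)
  | isAx3 (α : PathExpr A) : PDer (.union α α) α
  | isAx4 (α β γ : PathExpr A) : PDer (.comp α (.comp β γ)) (.comp (.comp α β) γ)
  | isAx5l (α : PathExpr A) : PDer (.comp .eps α) α
  | isAx5r (α : PathExpr A) : PDer (.comp α .eps) α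
  | isAx6l (α β γ : PathExpr A) :
      PDer (.comp α (.union β γ)) (.union (.comp α β) (.comp α γ))
  | isAx6r (α β γ : PathExpr A) :
      PDer (.comp (.union α β) γ) (.union (.comp α γ) (.comp β γ))
  | isAx7 (α : PathExpr A) : PDer (.union botP α) α
end

/-- A node expression is `XP⁻`-consistent if it is not provably equivalent to `⊥`. -/
def NConsistent [Fintype A] (φ : NodeExpr A) : Prop := ¬ NDer φ botN

/-- A path expression is `XP⁻`-consistent if it is not provably equivalent to `⊥̄`. -/
def PConsistent [Fintype A] (α : PathExpr A) : Prop := ¬ PDer α botP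

/-- The normal form `a ∧ ⋀_{d ∈ C} d ∧ ⋀_{d ∈ D∖C} ¬d`, built along the canonical listing `D`. -/
noncomputable def mkNF (a : A) (C D : List (NodeExpr A)) : NodeExpr A :=
  D.foldl (fun acc d => .conj acc (if d ∈ C then d else .neg d)) (.lab a)

/-- The canonical lists of normal-form path expressions (first component)
and normal-form node expressions (second component) at each level. -/
noncomputable def NF (A : Type) [Fintype A] : ℕ → List (PathExpr A) × List (NodeExpr A)
  | 0 =>
    ([.eps],
      (Finset.univ : Finset A).toList.map fun a =>
        NodeExpr.conj (.lab a) (.eqTest .eps .eps))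
  | n+1 =>
    let P := (NF A n).1
    let N := (NF A n).2
    let P' : List (PathExpr A) :=
      .eps :: N.flatMap fun ψ => P.map fun β => PathExpr.comp .down (.comp (.test ψ) β)
    let D : List (NodeExpr A) :=
      P'.flatMap fun α => P'.map fun β => NodeExpr.eqTest α β
    let cands : List (NodeExpr A) :=
      D.sublists.flatMap fun C => (Finset.univ : Finset A).toList.map fun a => mkNF a C D
    (P', cands.filter fun φ => decide (NConsistent φ))

/-- `P̂ₙ`: normal-form path expressions of level `n`. -/
noncomputable def Pnf (A : Type) [Fintype A] (n : ℕ) : Set (PathExpr A) :=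
  {α | α ∈ (NF A n).1}

/-- `N̂ₙ`: normal-form node expressions of level `n`. -/
noncomputable def Nnf (A : Type) [Fintype A] (n : ℕ) : Set (NodeExpr A) :=
  {φ | φ ∈ (NF A n).2}

/-- `D̂ₙ`: data-aware diamonds between normal-form paths of level `n`. -/
noncomputable def Dnf (A : Type) [Fintype A] (n : ℕ) : Set (NodeExpr A) :=
  {φ | ∃ α ∈ Pnf A n, ∃ β ∈ Pnf A n, φ = NodeExpr.eqTest α β}

/-- The conjuncts of a node expression (flattening `∧`). -/
def conjuncts : NodeExpr A → List (NodeExpr A)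
  | .conj φ ψ => conjuncts φ ++ conjuncts ψ
  | φ => [φ]

/-- `δ` is a conjunct of `ψ`. -/
def IsConjunct (δ ψ : NodeExpr A) : Prop := δ ∈ conjuncts ψ

/-- Length of a path expression. -/
def plen : PathExpr A → ℕ
  | .eps => 0
  | .down => 1
  | .test _ => 0
  | .comp α β => plen α + plen β
  | .union α β => max (plen α) (plen β)

mutual
/-- Downward depth of a node expression. -/
def ndd : NodeExpr A → ℕ
  | .lab _ => 0
  | .neg φ => ndd φ
  | .conj φ ψ => max (ndd φ) (ndd ψ)
  | .diam α => pdd α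
  | .eqTest α β => max (pdd α) (pdd β)

/-- Downward depth of a path expression. -/
def pdd : PathExpr A → ℕ
  | .eps => 0
  | .down => 1
  | .test φ => ndd φ
  | .comp α β => max (max (pdd α) (pdd β)) (plen α + pdd β)
  | .union α β => max (pdd α) (pdd β)
end

/-- The path `↓[ψ]α`. -/
def dPath (ψ : NodeExpr A) (α : PathExpr A) : PathExpr A :=
  .comp .down (.comp (.test ψ) α)

/-- A path expression whose leftmost symbol is `↓`. -/
def startsWithDown : PathExpr A → Prop
  | .down => True
  | .comp α _ => startsWithDown α
  | _ => False

end XPathMinus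

namespace XPathMinus

/-! ### Huntington algebras are Boolean algebras -/

section Huntington

variable {Q : Type} (s : Q → Q → Q) (n : Q → Q) (b : Q)

/-- Huntington's axioms (with idempotence and unit). -/
structure Hunt : Prop where
  comm : ∀ x y, s x y = s y x
  assoc : ∀ x y z, s (s x y) z = s x (s y z)
  idem : ∀ x, s x x = x
  unit : ∀ x, s b x = x
  hunt : ∀ x y, x = s (n (s (n x) y)) (n (s (n x) (n y)))

variable {s n b}

theorem Hunt.lcomm (h : Hunt s n b) (x y z : Q) : s x (s y z) = s y (s x z) := by
  rw [← h.assoc, h.comm x y, h.assoc]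

theorem Hunt.aux (h : Hunt s n b) (x : Q) : s x (n x) = s (n x) (n (n x)) := by
  have h1 := h.hunt x (n (n x))
  have h2 := h.hunt (n x) (n (n x))
  have h3 := h.hunt (n x) (n x)
  have h4 := h.hunt (n (n x)) (n x)
  have e1 : s x (n x) = s (s (n (s (n x) (n (n x)))) (n (s (n x) (n (n (n x))))))
      (s (n (s (n (n x)) (n (n x)))) (n (s (n (n x)) (n (n (n x)))))) := by
    rw [← h1, ← h2]
  have e2 : s (n x) (n (n x)) = s (s (n (s (n (n x)) (n x))) (n (s (n (n x)) (n (n x)))))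
      (s (n (s (n (n (n x))) (n x))) (n (s (n (n (n x))) (n (n x))))) := by
    rw [← h3, ← h4]
  refine e1.trans (Eq.trans ?_ e2.symm)
  rw [h.comm (n (n x)) (n x), h.comm (n (n (n x))) (n x),
    h.comm (n (n (n x))) (n (n x))]
  simp only [h.assoc]
  rw [h.lcomm (n (s (n x) (n (n (n x)))))]

theorem Hunt.dn (h : Hunt s n b) (x : Q) : n (n x) = x := by
  have h1 := h.hunt x (n (n x))
  have h4 := h.hunt (n (n x)) (n x)
  rw [h4, h.comm (n (n (n x))) (n (n x)), ← h.aux (n x), h.comm (n (n (n x))) (n x),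
    h.comm (n (s (n x) (n (n (n x)))))]
  exact h1.symm

theorem Hunt.const (h : Hunt s n b) (x y : Q) : s x (n x) = s y (n y) := by
  have h1 := h.hunt x y
  have h2 := h.hunt (n x) y
  have h3 := h.hunt y x
  have h4 := h.hunt (n y) x
  rw [h.dn] at h2 h4
  have e1 : s x (n x) = s (s (n (s (n x) y)) (n (s (n x) (n y))))
      (s (n (s x y)) (n (s x (n y)))) := by rw [← h1, ← h2]
  have e2 : s y (n y) = s (s (n (s (n y) x)) (n (s (n y) (n x))))
      (s (n (s y x)) (n (s y (n x)))) := by rw [← h3, ← h4]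
  rw [e1, e2, h.comm (n y) x, h.comm (n y) (n x), h.comm y x, h.comm y (n x)]
  generalize n (s (n x) y) = p
  generalize n (s (n x) (n y)) = q
  generalize n (s x y) = r
  generalize n (s x (n y)) = t
  calc s (s p q) (s r t) = s p (s q (s r t)) := h.assoc _ _ _
    _ = s p (s t (s q r)) := by rw [← h.assoc q r t, h.comm _ t]
    _ = s (s t q) (s r p) := by
      rw [h.assoc t q, h.lcomm p t, h.comm r p, h.lcomm q p]

theorem Hunt.bot_eq (h : Hunt s n b) (x : Q) : n (s x (n x)) = b := by
  have h1 := h.hunt b b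
  have h2 := h.unit (n (s x (n x)))
  have h3 : s b (n (s x (n x))) = b := by
    have := h.hunt b b
    rw [h.idem, h.dn, h.comm (n b) b, h.const b x, h.comm] at this
    exact this.symm
  rw [← h2, h3]

theorem Hunt.le_iff (h : Hunt s n b) (x y : Q) : s x y = y ↔ s (n x) y = n b := by
  constructor
  · intro e
    rw [← e, ← h.assoc, h.comm (n x) x, h.const x y, h.comm, h.comm y (n y), ← h.bot_eq y, h.dn]
    rw [← h.assoc, h.comm y, h.assoc, h.idem, h.comm]
  · intro e
    have h1 := h.hunt x y
    rw [e, h.dn, h.unit] at h1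
    have h2 := h.hunt y x
    rw [h.comm (n y) (n x), ← h1] at h2
    rw [h2, h.comm _ x, ← h.assoc, h.idem]

theorem Hunt.em (h : Hunt s n b) (x : Q) : s x (n x) = n b := by
  rw [← h.bot_eq x, h.dn]

theorem Hunt.anti (h : Hunt s n b) (x y : Q) : s x y = y ↔ s (n y) (n x) = n x := by
  rw [h.le_iff, h.le_iff, h.dn, h.comm]

theorem Hunt.adj (h : Hunt s n b) (x y z : Q) :
    s (n (s (n x) (n y))) z = z ↔ s x (s (n y) z) = s (n y) z := by
  rw [h.le_iff, h.le_iff, h.dn, h.assoc]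

/-- The lattice of a Huntington algebra. -/
@[reducible] def Hunt.toLat (h : Hunt s n b) : Lattice Q where
  le x y := s x y = y
  le_refl := h.idem
  le_trans x y z h1 h2 := by rw [← h2, ← h.assoc, h1]
  le_antisymm x y h1 h2 := by rw [← h1, h.comm]; exact h2.symm
  sup := s
  le_sup_left x y := by rw [← h.assoc, h.idem]
  le_sup_right x y := by rw [h.comm x y, ← h.assoc, h.idem]
  sup_le x y z h1 h2 := by rw [h.assoc, h2, h1]
  inf x y := n (s (n x) (n y))
  inf_le_left x y := by
    rw [h.anti, h.dn, ← h.assoc, h.idem]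
  inf_le_right x y := by
    rw [h.anti, h.dn, h.lcomm, h.idem]
  le_inf x y z h1 h2 := by
    rw [h.anti] at h1 h2
    rw [h.anti, h.dn, h.assoc, h2, h1]

/-- The Boolean algebra of a Huntington algebra. -/
@[reducible] def Hunt.toBA (h : Hunt s n b) : BooleanAlgebra Q where
  __ := h.toLat
  top := n b
  bot := b
  compl := n
  le_sup_inf x y z := by
    let _ := h.toLat
    have adj : ∀ x y z : Q, x ⊓ y ≤ z ↔ x ≤ n y ⊔ z := h.adj
    rw [adj]
    apply sup_le
    · exact le_sup_left.trans le_sup_right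
    · rw [← adj, inf_comm, adj]
      apply sup_le
      · exact le_sup_left.trans le_sup_right
      · rw [← adj, inf_comm]
        exact le_sup_right
  inf_compl_le_bot x := by
    change s (n (s (n x) (n (n x)))) b = b
    rw [h.em, h.dn, h.idem]
  top_le_sup_compl x := by
    change s (n b) (s x (n x)) = s x (n x)
    rw [h.em, h.idem]
  le_top x := by
    change s x (n b) = n b
    rw [← h.em x, ← h.assoc, h.idem]
  bot_le x := h.unit x

end Huntington
end XPathMinus
namespace XPathMinus

/-! ### The Lindenbaum algebra of `XP⁻` -/

section Lindenbaum

variable (A : Type) [Fintype A]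

def nSetoid : Setoid (NodeExpr A) := ⟨NDer, NDer.refl, NDer.symm, NDer.trans⟩
def pSetoid : Setoid (PathExpr A) := ⟨PDer, PDer.refl, PDer.symm, PDer.trans⟩
/-- Node expressions modulo provable equivalence. -/
def NQ : Type := Quotient (nSetoid A)
/-- Path expressions modulo provable equivalence. -/
def PQ : Type := Quotient (pSetoid A)

variable {A}

def qn (φ : NodeExpr A) : NQ A := Quotient.mk (nSetoid A) φ
def qp (α : PathExpr A) : PQ A := Quotient.mk (pSetoid A) α

theorem qn_sound {φ ψ : NodeExpr A} (h : NDer φ ψ) : qn φ = qn ψ := Quotient.sound h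
theorem qp_sound {α β : PathExpr A} (h : PDer α β) : qp α = qp β := Quotient.sound h
theorem qn_exact {φ ψ : NodeExpr A} (h : qn φ = qn ψ) : NDer φ ψ := Quotient.exact h
theorem qn_surj (x : NQ A) : ∃ φ, qn φ = x := Quotient.exists_rep x
theorem qp_surj (x : PQ A) : ∃ φ, qp φ = x := Quotient.exists_rep x

theorem nOr_congr {φ φ' ψ ψ' : NodeExpr A} (h1 : NDer φ φ') (h2 : NDer ψ ψ') :
    NDer (nOr φ ψ) (nOr φ' ψ') :=
  .congr_neg (.congr_conj (.congr_neg h1) (.congr_neg h2))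

def nNeg : NQ A → NQ A :=
  Quotient.lift (fun φ => qn (.neg φ)) fun _ _ h => qn_sound (.congr_neg h)
def nSup : NQ A → NQ A → NQ A :=
  Quotient.lift₂ (fun φ ψ => qn (nOr φ ψ)) fun _ _ _ _ h h' => qn_sound (nOr_congr h h')
def nInf : NQ A → NQ A → NQ A :=
  Quotient.lift₂ (fun φ ψ => qn (.conj φ ψ)) fun _ _ _ _ h h' => qn_sound (.congr_conj h h')
def nDiam : PQ A → NQ A :=
  Quotient.lift (fun α => qn (.diam α)) fun _ _ h => qn_sound (.congr_diam h)
def nEq : PQ A → PQ A → NQ A :=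
  Quotient.lift₂ (fun α β => qn (.eqTest α β)) fun _ _ _ _ h h' => qn_sound (.congr_eqTest h h')
def pTest : NQ A → PQ A :=
  Quotient.lift (fun φ => qp (.test φ)) fun _ _ h => qp_sound (.congr_test h)
def pComp : PQ A → PQ A → PQ A :=
  Quotient.lift₂ (fun α β => qp (.comp α β)) fun _ _ _ _ h h' => qp_sound (.congr_comp h h')
def pSup : PQ A → PQ A → PQ A :=
  Quotient.lift₂ (fun α β => qp (.union α β)) fun _ _ _ _ h h' => qp_sound (.congr_union h h')

theorem nOr_as_diam (φ ψ : NodeExpr A) :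
    NDer (nOr φ ψ) (.diam (.union (.test φ) (.test ψ))) :=
  ((NDer.ndAx3 _ _).trans (nOr_congr (.ndAx2 φ) (.ndAx2 ψ))).symm

theorem nOr_as_test (φ ψ : NodeExpr A) :
    NDer (nOr φ ψ) (.diam (.test (nOr φ ψ))) := (NDer.ndAx2 _).symm

theorem hunt_NQ : Hunt (nSup : NQ A → NQ A → NQ A) nNeg (qn botN) where
  comm := by
    rintro ⟨φ⟩ ⟨ψ⟩
    exact qn_sound ((nOr_as_diam _ _).trans ((NDer.congr_diam (.isAx2 _ _)).trans
      (nOr_as_diam _ _).symm))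
  assoc := by
    rintro ⟨φ⟩ ⟨ψ⟩ ⟨χ⟩
    exact qn_sound ((nOr_as_diam _ _).trans ((NDer.congr_diam
      ((PDer.congr_union (.prAx3 _ _) (.refl _)).trans ((PDer.isAx1 _ _ _).trans
        (PDer.congr_union (.refl _) (PDer.prAx3 _ _).symm)))).trans
      (nOr_as_diam _ _).symm))
  idem := by
    rintro ⟨φ⟩
    exact qn_sound ((nOr_as_diam _ _).trans ((NDer.congr_diam (.isAx3 _)).trans (.ndAx2 _)))
  unit := by
    rintro ⟨φ⟩
    exact qn_sound ((nOr_as_diam _ _).trans ((NDer.congr_diam (.isAx7 _)).trans (.ndAx2 _)))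
  hunt := by
    rintro ⟨φ⟩ ⟨ψ⟩
    exact qn_sound (.ndAx1 φ ψ)

instance instBANQ : BooleanAlgebra (NQ A) := hunt_NQ.toBA

theorem qn_neg (φ : NodeExpr A) : qn (.neg φ) = (qn φ)ᶜ := rfl
theorem qn_nOr (φ ψ : NodeExpr A) : qn (nOr φ ψ) = qn φ ⊔ qn ψ := rfl
theorem qn_bot : qn (botN : NodeExpr A) = ⊥ := rfl
theorem qn_top : qn (topN : NodeExpr A) = ⊤ := by
  rw [← compl_compl (qn topN), ← qn_neg]
  exact compl_bot
theorem qn_conj (φ ψ : NodeExpr A) : qn (.conj φ ψ) = qn φ ⊓ qn ψ := by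
  have h : qn (.conj (.neg (.neg φ)) (.neg (.neg ψ))) = qn φ ⊓ qn ψ := by
    rw [← compl_compl (qn (.conj (.neg (.neg φ)) (.neg (.neg ψ)))), ← qn_neg]
    change (qn (nOr (.neg φ) (.neg ψ)))ᶜ = _
    rw [qn_nOr, qn_neg, qn_neg, compl_sup, compl_compl, compl_compl]
  rw [← h]
  change nInf (qn φ) (qn ψ) = nInf (qn (.neg (.neg φ))) (qn (.neg (.neg ψ)))
  rw [qn_neg, qn_neg, qn_neg, qn_neg, compl_compl, compl_compl]

instance instSLPQ : SemilatticeSup (PQ A) where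
  le x y := pSup x y = y
  le_refl := by rintro ⟨α⟩; exact qp_sound (.isAx3 _)
  le_trans := by
    intro x y z h1 h2
    have e : ∀ x y z : PQ A, pSup (pSup x y) z = pSup x (pSup y z) := by
      rintro ⟨α⟩ ⟨β⟩ ⟨γ⟩; exact qp_sound (.isAx1 _ _ _)
    rw [← h2, ← e, h1]
  le_antisymm := by
    have e : ∀ x y : PQ A, pSup x y = pSup y x := by
      rintro ⟨α⟩ ⟨β⟩; exact qp_sound (.isAx2 _ _)
    intro x y h1 h2
    rw [← h1, e]; exact h2.symm
  sup := pSup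
  le_sup_left := by
    rintro ⟨α⟩ ⟨β⟩
    exact qp_sound ((PDer.isAx1 _ _ _).symm.trans (.congr_union (.isAx3 _) (.refl _)))
  le_sup_right := by
    rintro ⟨α⟩ ⟨β⟩
    exact qp_sound ((PDer.congr_union (.refl _) (.isAx2 _ _)).trans
      (((PDer.isAx1 _ _ _).symm.trans (.congr_union (.isAx3 _) (.refl _))).trans (.isAx2 _ _)))
  sup_le := by
    have e : ∀ x y z : PQ A, pSup (pSup x y) z = pSup x (pSup y z) := by
      rintro ⟨α⟩ ⟨β⟩ ⟨γ⟩; exact qp_sound (.isAx1 _ _ _)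
    intro x y z h1 h2
    rw [e, h2, h1]

theorem mono_of_sup {S T : Type} [SemilatticeSup S] [SemilatticeSup T] {f : S → T}
    (h : ∀ x y, f (x ⊔ y) = f x ⊔ f y) : Monotone f := by
  intro x y hxy
  rw [← sup_eq_right] at hxy ⊢
  rw [← h, hxy]

/-- The identity path. -/
def pEps : PQ A := qp .eps
/-- The empty path. -/
def pBot : PQ A := qp botP

theorem pBot_le (x : PQ A) : pBot ≤ x := by
  obtain ⟨α, rfl⟩ := qp_surj x; exact qp_sound (.isAx7 α)
theorem pTest_sup (x y : NQ A) : pTest (x ⊔ y) = pTest x ⊔ pTest y := by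
  obtain ⟨α, rfl⟩ := qn_surj x; obtain ⟨β, rfl⟩ := qn_surj y; exact qp_sound (.prAx3 _ _)
theorem pTest_top : pTest (⊤ : NQ A) = pEps := by
  rw [← qn_top]; exact qp_sound .prAx2
theorem pTest_bot : pTest (⊥ : NQ A) = pBot := rfl
theorem pComp_sup (x y z : PQ A) : pComp x (y ⊔ z) = pComp x y ⊔ pComp x z := by
  obtain ⟨α, rfl⟩ := qp_surj x; obtain ⟨β, rfl⟩ := qp_surj y; obtain ⟨γ, rfl⟩ := qp_surj z
  exact qp_sound (.isAx6l _ _ _)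
theorem pSup_comp (x y z : PQ A) : pComp (x ⊔ y) z = pComp x z ⊔ pComp y z := by
  obtain ⟨α, rfl⟩ := qp_surj x; obtain ⟨β, rfl⟩ := qp_surj y; obtain ⟨γ, rfl⟩ := qp_surj z
  exact qp_sound (.isAx6r _ _ _)
theorem pComp_assoc (x y z : PQ A) : pComp (pComp x y) z = pComp x (pComp y z) := by
  obtain ⟨α, rfl⟩ := qp_surj x; obtain ⟨β, rfl⟩ := qp_surj y; obtain ⟨γ, rfl⟩ := qp_surj z
  exact qp_sound (PDer.isAx4 _ _ _).symm
theorem pEps_comp (x : PQ A) : pComp pEps x = x := by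
  obtain ⟨α, rfl⟩ := qp_surj x; exact qp_sound (.isAx5l _)
theorem pComp_eps (x : PQ A) : pComp x pEps = x := by
  obtain ⟨α, rfl⟩ := qp_surj x; exact qp_sound (.isAx5r _)
theorem pComp_ann (x y : PQ A) : pComp (pComp x (pTest (nDiam y)ᶜ)) y = pBot := by
  obtain ⟨α, rfl⟩ := qp_surj x; obtain ⟨β, rfl⟩ := qp_surj y; exact qp_sound (.prAx1 _ _)
theorem nDiam_test (x : NQ A) : nDiam (pTest x) = x := by
  obtain ⟨α, rfl⟩ := qn_surj x; exact qn_sound (.ndAx2 _)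
theorem nDiam_sup (x y : PQ A) : nDiam (x ⊔ y) = nDiam x ⊔ nDiam y := by
  obtain ⟨α, rfl⟩ := qp_surj x; obtain ⟨β, rfl⟩ := qp_surj y; exact qn_sound (.ndAx3 _ _)
theorem nDiam_comp (x y : PQ A) : nDiam (pComp x y) = nDiam (pComp x (pTest (nDiam y))) := by
  obtain ⟨α, rfl⟩ := qp_surj x; obtain ⟨β, rfl⟩ := qp_surj y; exact qn_sound (.ndAx4 _ _)
theorem nEq_comm (x y : PQ A) : nEq x y = nEq y x := by
  obtain ⟨α, rfl⟩ := qp_surj x; obtain ⟨β, rfl⟩ := qp_surj y; exact qn_sound (.eqAx1 _ _)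
theorem nEq_sup (x y z : PQ A) : nEq (x ⊔ y) z = nEq x z ⊔ nEq y z := by
  obtain ⟨α, rfl⟩ := qp_surj x; obtain ⟨β, rfl⟩ := qp_surj y; obtain ⟨γ, rfl⟩ := qp_surj z
  exact qn_sound (.eqAx2 _ _ _)
theorem nEq_le (x y : PQ A) : nEq x y ≤ nDiam x := by
  obtain ⟨α, rfl⟩ := qp_surj x; obtain ⟨β, rfl⟩ := qp_surj y; exact qn_sound (.eqAx4 _ _)
theorem nEq_five (z x y : PQ A) :
    nDiam (pComp z (pTest (nEq x y))) ≤ nEq (pComp z x) (pComp z y) := by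
  obtain ⟨α, rfl⟩ := qp_surj x; obtain ⟨β, rfl⟩ := qp_surj y; obtain ⟨γ, rfl⟩ := qp_surj z
  exact qn_sound (.eqAx5 _ _ _)
theorem nEq_self (x : PQ A) : nEq x x = nDiam x := by
  obtain ⟨α, rfl⟩ := qp_surj x; exact qn_sound (.eqAx6 _)
theorem nEq_seven (x y : PQ A) : nEq x pEps ⊓ nEq y pEps ≤ nEq x y := by
  obtain ⟨α, rfl⟩ := qp_surj x; obtain ⟨β, rfl⟩ := qp_surj y
  have h := qn_sound (NDer.eqAx7 α β)
  rw [qn_nOr, qn_conj] at h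
  exact sup_eq_right.1 h
theorem nEq_eight (x y z : PQ A) :
    nEq x (pComp y (pTest (nEq pEps z))) ≤ nEq x (pComp y z) := by
  obtain ⟨α, rfl⟩ := qp_surj x; obtain ⟨β, rfl⟩ := qp_surj y; obtain ⟨γ, rfl⟩ := qp_surj z
  exact qn_sound (.eqAx8 _ _ _)

theorem pTest_mono : Monotone (pTest : NQ A → PQ A) := mono_of_sup pTest_sup
theorem nDiam_mono : Monotone (nDiam : PQ A → NQ A) := mono_of_sup nDiam_sup
theorem pComp_mono_r (x : PQ A) : Monotone (pComp x) := mono_of_sup (pComp_sup x)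
theorem pComp_mono_l (z : PQ A) : Monotone (fun x => pComp x z) :=
  mono_of_sup fun x y => pSup_comp x y z
theorem nEq_mono_l (z : PQ A) : Monotone (fun x => nEq x z) :=
  mono_of_sup fun x y => nEq_sup x y z

theorem nDiam_bot : nDiam (pBot : PQ A) = ⊥ := by rw [← pTest_bot, nDiam_test]
theorem nDiam_eps : nDiam (pEps : PQ A) = ⊤ := by rw [← pTest_top, nDiam_test]

theorem pTest_compl (x : NQ A) : pComp (pTest x) (pTest xᶜ) = pBot := by
  have h := pComp_ann (pEps : PQ A) (pTest xᶜ)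
  rwa [nDiam_test, compl_compl, pEps_comp] at h

/-- If `x ≤ y` then `[x] ≡ [x][y]`. -/
theorem pTest_absorb {x y : NQ A} (h : x ≤ y) : pComp (pTest x) (pTest y) = pTest x := by
  have e : pTest x = pComp (pTest x) (pTest y) ⊔ pComp (pTest x) (pTest yᶜ) := by
    rw [← pComp_sup, ← pTest_sup, sup_compl_eq_top, pTest_top, pComp_eps]
  have h2 : pComp (pTest x) (pTest yᶜ) ≤ pBot := by
    rw [← pTest_compl x]
    exact pComp_mono_r _ (pTest_mono (compl_le_compl h))
  rw [sup_eq_left.2 (h2.trans (pBot_le _))] at e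
  exact e.symm

theorem nDiam_comp_le (x y : PQ A) : nDiam (pComp x y) ≤ nDiam x := by
  rw [nDiam_comp]
  refine nDiam_mono ?_
  conv_rhs => rw [← pComp_eps x]
  exact pComp_mono_r _ (pTest_top (A := A) ▸ pTest_mono le_top)

/-- The path `↓[ψ₁]↓[ψ₂]…↓[ψₖ]`. -/
def pathOf : List (NodeExpr A) → PathExpr A
  | [] => .eps
  | ψ :: l => .comp .down (.comp (.test ψ) (pathOf l))

/-- `⟨l = m⟩` in the Lindenbaum algebra. -/
def E (l m : List (NodeExpr A)) : NQ A := qn (.eqTest (pathOf l) (pathOf m))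

theorem E_def (l m : List (NodeExpr A)) : E l m = nEq (qp (pathOf l)) (qp (pathOf m)) := rfl

theorem qp_pathOf_nil : qp (pathOf ([] : List (NodeExpr A))) = pEps := rfl
theorem qp_pathOf_cons (ψ : NodeExpr A) (l : List (NodeExpr A)) :
    qp (pathOf (ψ :: l)) = pComp (pComp (qp .down) (pTest (qn ψ))) (qp (pathOf l)) := by
  rw [pComp_assoc]; rfl

theorem qp_pathOf_append (l m : List (NodeExpr A)) :
    qp (pathOf (l ++ m)) = pComp (qp (pathOf l)) (qp (pathOf m)) := by
  induction l with
  | nil => rw [qp_pathOf_nil, pEps_comp]; rfl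
  | cons ψ l ih => rw [List.cons_append, qp_pathOf_cons, qp_pathOf_cons, ih, ← pComp_assoc]

theorem E_comm (l m : List (NodeExpr A)) : E l m = E m l := by
  rw [E_def, E_def, nEq_comm]
theorem E_nil : E ([] : List (NodeExpr A)) [] = ⊤ := by
  rw [E_def, nEq_self, qp_pathOf_nil, nDiam_eps]
theorem E_left (l m : List (NodeExpr A)) : E l m ≤ E l l := by
  rw [E_def, E_def, nEq_self]; exact nEq_le _ _
theorem E_seven (l m : List (NodeExpr A)) : E [] l ⊓ E [] m ≤ E l m := by
  rw [E_comm [] l, E_comm [] m, E_def, E_def, E_def]; exact nEq_seven _ _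
theorem E_head (ψ : NodeExpr A) (l : List (NodeExpr A)) : E (ψ :: l) (ψ :: l) ≤ E [ψ] [ψ] := by
  rw [E_def, E_def, nEq_self, nEq_self, qp_pathOf_cons, qp_pathOf_cons, qp_pathOf_nil, pComp_eps]
  exact nDiam_comp_le _ _

theorem E_inside {ψ : NodeExpr A} {l m : List (NodeExpr A)} (h : qn ψ ≤ E l m) :
    E [ψ] [ψ] ≤ E (ψ :: l) (ψ :: m) := by
  rw [E_def [ψ], E_def (ψ :: l), nEq_self, qp_pathOf_cons, qp_pathOf_cons, qp_pathOf_cons,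
    qp_pathOf_nil, pComp_eps]
  refine le_trans ?_ (nEq_five _ _ _)
  rw [pComp_assoc, ← E_def, pTest_absorb h]

theorem absorb_last {ψ : NodeExpr A} {l : List (NodeExpr A)} {x : NQ A}
    (h : qn (l.getLastD ψ) ≤ x) :
    pComp (qp (pathOf (ψ :: l))) (pTest x) = qp (pathOf (ψ :: l)) := by
  induction l generalizing ψ with
  | nil =>
    rw [qp_pathOf_cons, qp_pathOf_nil, pComp_eps, pComp_assoc]
    rw [List.getLastD_nil] at h
    rw [pTest_absorb h]
  | cons χ l ih =>
    rw [List.getLastD_cons] at h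
    rw [qp_pathOf_cons, pComp_assoc, ih h]

theorem E_extend {ψ : NodeExpr A} {l m : List (NodeExpr A)} (k : List (NodeExpr A))
    (h : qn (l.getLastD ψ) ≤ E [] m) : E k (ψ :: l) ≤ E k (ψ :: (l ++ m)) := by
  rw [← List.cons_append, E_def k, E_def k, qp_pathOf_append]
  refine le_trans ?_ (nEq_eight _ _ _)
  rw [← qp_pathOf_nil, ← E_def [] m, absorb_last h]

theorem E_dead {ψ : NodeExpr A} {l : List (NodeExpr A)} (h : qn ψ ≤ (E l l)ᶜ) :
    E (ψ :: l) (ψ :: l) = ⊥ := by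
  rw [E_def, nEq_self] at *
  rw [qp_pathOf_cons, ← pTest_absorb h, ← pComp_assoc, pComp_ann, nDiam_bot]

end Lindenbaum
end XPathMinus
namespace XPathMinus

/-! ### Analysis of normal forms -/

section NormalForms

variable {A : Type} [Fintype A]

/-- Lists of node expressions describing a path of `P̂ₙ`. -/
def VL : ℕ → List (NodeExpr A) → Prop
  | _, [] => True
  | 0, _ :: _ => False
  | n + 1, ψ :: l => ψ ∈ (NF A n).2 ∧ VL n l

theorem VL_nil (n : ℕ) : VL n ([] : List (NodeExpr A)) := by cases n <;> trivial

theorem mem_P (n : ℕ) (α : PathExpr A) : α ∈ (NF A n).1 ↔ ∃ l, VL n l ∧ α = pathOf l := by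
  induction n generalizing α with
  | zero =>
    simp only [NF, List.mem_singleton]
    constructor
    · rintro rfl; exact ⟨[], trivial, rfl⟩
    · rintro ⟨_ | ⟨ψ, l⟩, h, rfl⟩
      · rfl
      · exact h.elim
  | succ n ih =>
    simp only [NF, List.mem_cons, List.mem_flatMap, List.mem_map]
    constructor
    · rintro (rfl | ⟨ψ, hψ, β, hβ, rfl⟩)
      · exact ⟨[], trivial, rfl⟩
      · obtain ⟨l, hl, rfl⟩ := (ih β).1 hβ
        exact ⟨ψ :: l, ⟨hψ, hl⟩, rfl⟩
    · rintro ⟨_ | ⟨ψ, l⟩, h, rfl⟩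
      · exact Or.inl rfl
      · exact Or.inr ⟨ψ, h.1, pathOf l, (ih _).2 ⟨l, h.2, rfl⟩, rfl⟩

/-- The list `D̂ₙ`. -/
noncomputable def DL (A : Type) [Fintype A] (n : ℕ) : List (NodeExpr A) :=
  (NF A n).1.flatMap fun α => (NF A n).1.map fun β => NodeExpr.eqTest α β

theorem mem_DL (n : ℕ) (d : NodeExpr A) :
    d ∈ DL A n ↔ ∃ l m, VL n l ∧ VL n m ∧ d = .eqTest (pathOf l) (pathOf m) := by
  simp only [DL, List.mem_flatMap, List.mem_map, mem_P]
  constructor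
  · rintro ⟨_, ⟨l, hl, rfl⟩, _, ⟨m, hm, rfl⟩, rfl⟩
    exact ⟨l, m, hl, hm, rfl⟩
  · rintro ⟨l, m, hl, hm, rfl⟩
    exact ⟨_, ⟨l, hl, rfl⟩, _, ⟨m, hm, rfl⟩, rfl⟩

theorem mem_N {n : ℕ} {φ : NodeExpr A} (h : φ ∈ (NF A n).2) :
    ∃ a C, φ = mkNF a C (DL A n) ∧ (n = 0 → ∀ d ∈ DL A n, d ∈ C) ∧
      (0 < n → qn φ ≠ ⊥) := by
  cases n with
  | zero =>
    simp only [NF, List.mem_map] at h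
    obtain ⟨a, -, rfl⟩ := h
    refine ⟨a, DL A 0, ?_, fun _ d hd => hd, fun h => absurd h (lt_irrefl _)⟩
    simp [mkNF, DL, NF]
  | succ n =>
    have h' := h
    simp only [NF, List.mem_filter, List.mem_flatMap, List.mem_map, decide_eq_true_eq] at h'
    obtain ⟨⟨C, -, a, -, rfl⟩, hc⟩ := h'
    refine ⟨a, C, rfl, fun h => by omega, fun _ hb => hc (qn_exact hb)⟩

theorem nsem_mkNF (T : DataTree A) (x : T.X) (a : A) (C D : List (NodeExpr A)) :
    nsem T (mkNF a C D) x ↔ T.label x = a ∧ ∀ d ∈ D, (nsem T d x ↔ d ∈ C) := by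
  have key : ∀ (D : List (NodeExpr A)) (acc : NodeExpr A),
      nsem T (D.foldl (fun acc d => .conj acc (if d ∈ C then d else .neg d)) acc) x ↔
        nsem T acc x ∧ ∀ d ∈ D, (nsem T d x ↔ d ∈ C) := by
    intro D
    induction D with
    | nil => intro acc; simp
    | cons d D ih =>
      intro acc
      rw [List.foldl_cons, ih]
      simp only [nsem, List.forall_mem_cons, and_assoc]
      by_cases hd : d ∈ C <;> simp [hd, nsem]
  rw [mkNF, key]
  simp only [nsem]

theorem qn_mkNF (a : A) (C D : List (NodeExpr A)) {d : NodeExpr A} (hd : d ∈ D) :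
    (d ∈ C → qn (mkNF a C D) ≤ qn d) ∧ (d ∉ C → qn (mkNF a C D) ≤ (qn d)ᶜ) := by
  have key : ∀ (D : List (NodeExpr A)) (acc : NodeExpr A),
      qn (D.foldl (fun acc d => .conj acc (if d ∈ C then d else .neg d)) acc) ≤ qn acc ∧
      ∀ d ∈ D, (d ∈ C →
        qn (D.foldl (fun acc d => .conj acc (if d ∈ C then d else .neg d)) acc) ≤ qn d) ∧
        (d ∉ C →
        qn (D.foldl (fun acc d => .conj acc (if d ∈ C then d else .neg d)) acc) ≤ (qn d)ᶜ) := by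
    intro D
    induction D with
    | nil => intro acc; simp
    | cons d D ih =>
      intro acc
      rw [List.foldl_cons]
      obtain ⟨h1, h2⟩ := ih (.conj acc (if d ∈ C then d else .neg d))
      rw [qn_conj] at h1
      refine ⟨h1.trans inf_le_left, ?_⟩
      intro e he
      rcases List.mem_cons.1 he with rfl | he
      · refine ⟨fun hC => ?_, fun hC => ?_⟩
        · rw [if_pos hC] at h1 ⊢
          exact h1.trans inf_le_right
        · rw [if_neg hC] at h1 ⊢
          exact h1.trans inf_le_right
      · exact h2 e he
  exact (key D (.lab a)).2 d hd

theorem N_spec {n : ℕ} {φ : NodeExpr A} (h : φ ∈ (NF A n).2) :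
    ∃ a, (∀ (T : DataTree A) (x : T.X), nsem T φ x ↔ T.label x = a ∧
        ∀ l m, VL n l → VL n m →
          (nsem T (.eqTest (pathOf l) (pathOf m)) x ↔ qn φ ≤ E l m)) ∧
      (∀ l m, VL n l → VL n m → qn φ ≤ E l m ∨ qn φ ≤ (E l m)ᶜ) ∧
      (0 < n → qn φ ≠ ⊥) := by
  obtain ⟨a, C, rfl, h0, h1⟩ := mem_N h
  have hiff : ∀ l m, VL n l → VL n m →
      (qn (mkNF a C (DL A n)) ≤ E l m ↔ NodeExpr.eqTest (pathOf l) (pathOf m) ∈ C) := by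
    intro l m hl hm
    have hd : NodeExpr.eqTest (pathOf l) (pathOf m) ∈ DL A n :=
      (mem_DL n _).2 ⟨l, m, hl, hm, rfl⟩
    have hq := qn_mkNF a C (DL A n) hd
    refine ⟨fun hle => ?_, hq.1⟩
    by_contra hC
    rcases Nat.eq_zero_or_pos n with hn | hn
    · exact hC (h0 hn _ hd)
    · apply h1 hn
      have := le_inf hle (hq.2 hC)
      rw [E, inf_compl_self] at this
      exact le_bot_iff.1 this
  refine ⟨a, fun T x => ?_, fun l m hl hm => ?_, h1⟩
  · rw [nsem_mkNF]
    refine and_congr_right fun _ => ?_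
    constructor
    · intro hh l m hl hm
      rw [hiff l m hl hm]
      exact hh _ ((mem_DL n _).2 ⟨l, m, hl, hm, rfl⟩)
    · intro hh d hd
      obtain ⟨l, m, hl, hm, rfl⟩ := (mem_DL n d).1 hd
      rw [← hiff l m hl hm]
      exact hh l m hl hm
  · have hd : NodeExpr.eqTest (pathOf l) (pathOf m) ∈ DL A n :=
      (mem_DL n _).2 ⟨l, m, hl, hm, rfl⟩
    have hq := qn_mkNF a C (DL A n) hd
    by_cases hC : NodeExpr.eqTest (pathOf l) (pathOf m) ∈ C
    · exact Or.inl (hq.1 hC)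
    · exact Or.inr (hq.2 hC)

theorem mkNF_congr (a : A) (C C' D : List (NodeExpr A)) (h : ∀ d ∈ D, (d ∈ C ↔ d ∈ C')) :
    mkNF a C D = mkNF a C' D := by
  unfold mkNF
  generalize NodeExpr.lab a = acc
  induction D generalizing acc with
  | nil => rfl
  | cons d D ih =>
    rw [List.foldl_cons, List.foldl_cons]
    have hd := h d (by simp)
    have e : (if d ∈ C then d else NodeExpr.neg d) = (if d ∈ C' then d else .neg d) := by
      by_cases h1 : d ∈ C
      · rw [if_pos h1, if_pos (hd.1 h1)]
      · rw [if_neg h1, if_neg (fun h2 => h1 (hd.2 h2))]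
    rw [e]
    exact ih (fun d' hd' => h d' (List.mem_cons_of_mem _ hd')) _

theorem N_unique {n : ℕ} {φ ψ : NodeExpr A} (h : φ ∈ (NF A n).2) (h' : ψ ∈ (NF A n).2)
    (T : DataTree A) (x : T.X) (hφ : nsem T φ x) (hψ : nsem T ψ x) : φ = ψ := by
  obtain ⟨a, C, rfl, -⟩ := mem_N h
  obtain ⟨b, C', rfl, -⟩ := mem_N h'
  rw [nsem_mkNF] at hφ hψ
  obtain rfl : a = b := hφ.1.symm.trans hψ.1
  exact mkNF_congr _ _ _ _ fun d hd => (hφ.2 d hd).symm.trans (hψ.2 d hd)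

theorem N_live {n : ℕ} {φ ψ : NodeExpr A} {l : List (NodeExpr A)} (h : φ ∈ (NF A (n + 1)).2)
    (hψ : ψ ∈ (NF A n).2) (hl : VL n l) (hle : qn φ ≤ E (ψ :: l) (ψ :: l)) :
    qn ψ ≤ E l l := by
  obtain ⟨a, -, -, hne⟩ := N_spec h
  obtain ⟨b, -, hd, -⟩ := N_spec hψ
  rcases hd l l hl hl with h1 | h1
  · exact h1
  · rw [E_dead h1] at hle
    exact absurd (le_bot_iff.1 hle) (hne (Nat.succ_pos n))

end NormalForms

/-! ### Gluing data trees -/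

section Glue

variable {A : Type}

/-- Embedding of a data tree as a full subtree. -/
structure Emb (S T : DataTree A) (f : S.X → T.X) : Prop where
  inj : Function.Injective f
  child : ∀ x w, T.child (f x) w ↔ ∃ y, w = f y ∧ S.child x y
  label : ∀ x, T.label (f x) = S.label x
  eqd : ∀ x y, T.eqd (f x) (f y) ↔ S.eqd x y

mutual
theorem emb_p {S T : DataTree A} {f : S.X → T.X} (h : Emb S T f) :
    ∀ (α : PathExpr A) (x : S.X) (w : T.X),
      psem T α (f x) w ↔ ∃ y, w = f y ∧ psem S α x y
  | .eps, x, w => by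
    simp only [psem]
    constructor
    · rintro rfl; exact ⟨x, rfl, rfl⟩
    · rintro ⟨y, rfl, rfl⟩; rfl
  | .down, x, w => by
    simp only [psem]
    exact h.child x w
  | .test φ, x, w => by
    simp only [psem]
    rw [emb_n h φ x]
    constructor
    · rintro ⟨rfl, hx⟩; exact ⟨x, rfl, rfl, hx⟩
    · rintro ⟨y, rfl, rfl, hx⟩; exact ⟨rfl, hx⟩
  | .comp α β, x, w => by
    simp only [psem]
    constructor
    · rintro ⟨y, h1, h2⟩
      obtain ⟨y', rfl, h3⟩ := (emb_p h α x y).1 h1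
      obtain ⟨z, rfl, h4⟩ := (emb_p h β y' w).1 h2
      exact ⟨z, rfl, y', h3, h4⟩
    · rintro ⟨z, rfl, y, h1, h2⟩
      exact ⟨f y, (emb_p h α x _).2 ⟨y, rfl, h1⟩, (emb_p h β y _).2 ⟨z, rfl, h2⟩⟩
  | .union α β, x, w => by
    simp only [psem]
    rw [emb_p h α x w, emb_p h β x w, ← exists_or]
    simp only [and_or_left]

theorem emb_n {S T : DataTree A} {f : S.X → T.X} (h : Emb S T f) :
    ∀ (φ : NodeExpr A) (x : S.X), nsem T φ (f x) ↔ nsem S φ x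
  | .lab a, x => by simp only [nsem, h.label]
  | .neg φ, x => by simp only [nsem]; rw [emb_n h φ x]
  | .conj φ ψ, x => by simp only [nsem]; rw [emb_n h φ x, emb_n h ψ x]
  | .diam α, x => by
    simp only [nsem]
    constructor
    · rintro ⟨w, hw⟩
      obtain ⟨y, -, hy⟩ := (emb_p h α x w).1 hw
      exact ⟨y, hy⟩
    · rintro ⟨y, hy⟩
      exact ⟨f y, (emb_p h α x _).2 ⟨y, rfl, hy⟩⟩
  | .eqTest α β, x => by
    simp only [nsem]
    constructor
    · rintro ⟨w, w', hw, hw', he⟩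
      obtain ⟨y, rfl, hy⟩ := (emb_p h α x w).1 hw
      obtain ⟨y', rfl, hy'⟩ := (emb_p h β x w').1 hw'
      exact ⟨y, y', hy, hy', (h.eqd _ _).1 he⟩
    · rintro ⟨y, y', hy, hy', he⟩
      exact ⟨f y, f y', (emb_p h α x _).2 ⟨y, rfl, hy⟩, (emb_p h β x _).2 ⟨y', rfl, hy'⟩,
        (h.eqd _ _).2 he⟩
end

variable {I K : Type} (T : I → DataTree A) (pt : ∀ i, (T i).X) (key : I → K) (k₀ : K)

/-- Child relation of the glued tree. -/
inductive GChild : Option (Σ i, (T i).X) → Option (Σ i, (T i).X) → Prop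
  | root (i : I) : GChild none (some ⟨i, (T i).root⟩)
  | step (i : I) (x y : (T i).X) : (T i).child x y → GChild (some ⟨i, x⟩) (some ⟨i, y⟩)

/-- Data class of a node of the glued tree: the class of `pt i` in each copy gets the
global name `key i`, the root gets `k₀`; other classes stay local. -/
noncomputable def gcls : Option (Σ i, (T i).X) → K ⊕ (Σ i, Set (T i).X)
  | none => .inl k₀
  | some ⟨i, x⟩ => if (T i).eqd (pt i) x then .inl (key i) else .inr ⟨i, {y | (T i).eqd x y}⟩

theorem gchild_trans {u w : Option (Σ i, (T i).X)} (h : Relation.TransGen (GChild T) u w) :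
    ∀ (i : I) (x : (T i).X), u = some ⟨i, x⟩ →
      ∃ y, w = some ⟨i, y⟩ ∧ Relation.TransGen (T i).child x y := by
  induction h with
  | single h =>
    rintro i x rfl
    cases h with
    | step _ _ y hy => exact ⟨y, rfl, .single hy⟩
  | tail _ h ih =>
    intro i x hx
    obtain ⟨y, rfl, hy⟩ := ih i x hx
    cases h with
    | step _ _ z hz => exact ⟨z, rfl, hy.tail hz⟩

/-- The glued tree. -/
noncomputable def glue (a : A) : DataTree A where
  X := Option (Σ i, (T i).X)
  child := GChild T
  root := none
  label x := match x with
    | none => a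
    | some ⟨i, x⟩ => (T i).label x
  eqd x y := gcls T pt key k₀ x = gcls T pt key k₀ y
  eqd_equiv := ⟨fun _ => rfl, fun h => h.symm, fun h h' => h.trans h'⟩
  parent_unique := by
    intro x y z h1 h2
    cases h1 with
    | root i =>
      generalize hz : (T i).root = z at h2
      cases h2 with
      | root => rfl
      | step _ x y h => subst hz; exact absurd h ((T i).root_no_parent _)
    | step i x y h =>
      generalize hz : y = z at h2
      cases h2 with
      | root => subst hz; exact absurd h ((T i).root_no_parent _)
      | step _ x' y' h' => subst hz; rw [(T i).parent_unique h h']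
  root_no_parent := by
    intro x h
    cases h
  reach := by
    rintro (_ | ⟨i, x⟩)
    · exact .refl
    · refine .head (.root i) ?_
      induction (T i).reach x with
      | refl => exact .refl
      | tail _ h ih => exact ih.tail (.step i _ _ h)
  acyclic := by
    rintro (_ | ⟨i, x⟩) h
    · obtain ⟨y, -, h⟩ := Relation.TransGen.tail'_iff.1 h
      cases h
    · obtain ⟨y, hy, h⟩ := gchild_trans T h i x rfl
      cases hy
      exact (T i).acyclic _ h

theorem gcls_pt (i : I) : gcls T pt key k₀ (some ⟨i, pt i⟩) = .inl (key i) := by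
  rw [gcls, if_pos ((T i).eqd_equiv.refl _)]

theorem gcls_same (i : I) (x y : (T i).X) :
    gcls T pt key k₀ (some ⟨i, x⟩) = gcls T pt key k₀ (some ⟨i, y⟩) ↔ (T i).eqd x y := by
  have eq := (T i).eqd_equiv
  simp only [gcls]
  constructor
  · intro h
    split_ifs at h with h1 h2 h2
    · exact eq.trans (eq.symm h1) h2
    · have h := Sum.inr.inj h
      have h := eq_of_heq (Sigma.mk.inj h).2
      have hy : y ∈ {z | (T i).eqd y z} := eq.refl y
      rw [← h] at hy
      exact hy
  · intro h
    by_cases h1 : (T i).eqd (pt i) x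
    · rw [if_pos h1, if_pos (eq.trans h1 h)]
    · rw [if_neg h1, if_neg (fun h2 => h1 (eq.trans h2 (eq.symm h)))]
      congr 2
      ext z
      exact ⟨fun hz => eq.trans (eq.symm h) hz, fun hz => eq.trans h hz⟩

theorem gcls_ne {i j : I} (hij : i ≠ j) {x : (T i).X} {y : (T j).X}
    (h : gcls T pt key k₀ (some ⟨i, x⟩) = gcls T pt key k₀ (some ⟨j, y⟩)) :
    key i = key j ∧ (T i).eqd (pt i) x ∧ (T j).eqd (pt j) y := by
  simp only [gcls] at h
  split_ifs at h with h1 h2 h2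
  · exact ⟨Sum.inl.inj h, h1, h2⟩
  · exact absurd (Sigma.mk.inj (Sum.inr.inj h)).1 hij

theorem gcls_root {i : I} {x : (T i).X}
    (h : gcls T pt key k₀ none = gcls T pt key k₀ (some ⟨i, x⟩)) :
    k₀ = key i ∧ (T i).eqd (pt i) x := by
  simp only [gcls] at h
  split_ifs at h with h1
  exact ⟨Sum.inl.inj h, h1⟩

theorem glue_emb (a : A) (i : I) :
    Emb (T i) (glue T pt key k₀ a) (fun x => some (⟨i, x⟩ : Σ i, (T i).X)) where
  inj x y h := by
    have h := Option.some.inj h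
    exact eq_of_heq (Sigma.mk.inj h).2
  child x w := by
    constructor
    · intro h
      cases h with
      | step _ _ y h => exact ⟨y, rfl, h⟩
    · rintro ⟨y, rfl, h⟩
      exact .step i x y h
  label x := rfl
  eqd x y := gcls_same T pt key k₀ i x y

end Glue
end XPathMinus
namespace XPathMinus

/-! ### The canonical model of a normal form -/

section Model

variable {A : Type} [Fintype A]

/-- `x` is a generic endpoint of the path `l` in a model `T` of `φ`. -/
def Generic (n : ℕ) (φ : NodeExpr A) (T : DataTree A) (l : List (NodeExpr A)) (x : T.X) : Prop :=
  psem T (pathOf l) T.root x ∧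
    ∀ l' y, VL n l' → psem T (pathOf l') T.root y → T.eqd x y →
      ∃ m, l' = l ++ m ∧ qn (l.getLastD φ) ≤ E [] m

/-- `T` is a model of `φ` with enough generic endpoints. -/
def Good (n : ℕ) (φ : NodeExpr A) (T : DataTree A) : Prop :=
  nsem T φ T.root ∧ ∀ l, VL n l → qn φ ≤ E l l → ∃ x, Generic n φ T l x

/-- Names of the merged data classes. -/
inductive Key (A : Type) : Type
  | root : Key A
  | fresh : NodeExpr A → Key A
  | pair : List (NodeExpr A) → List (NodeExpr A) → Key A

/-- Which copies are attached below the root, and with which merged class. -/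
def ValidIdx (φ : NodeExpr A) (ψ : NodeExpr A) (l : List (NodeExpr A)) : Key A → Prop
  | .root => qn φ ≤ E [] (ψ :: l)
  | .fresh χ => χ = ψ ∧ l = [] ∧ qn φ ≤ E [ψ] [ψ]
  | .pair L M => qn φ ≤ E L M ∧ (L = ψ :: l ∨ M = ψ :: l)

theorem ValidIdx.self {φ ψ : NodeExpr A} {l : List (NodeExpr A)} {k : Key A}
    (h : ValidIdx φ ψ l k) : qn φ ≤ E (ψ :: l) (ψ :: l) := by
  cases k with
  | root =>
    have h : qn φ ≤ E [] (ψ :: l) := h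
    rw [E_comm] at h
    exact h.trans (E_left _ _)
  | fresh χ =>
    obtain ⟨-, rfl, h⟩ := h
    exact h
  | pair L M =>
    obtain ⟨h, rfl | rfl⟩ := h
    · exact h.trans (E_left _ _)
    · rw [E_comm] at h
      exact h.trans (E_left _ _)

theorem ValidIdx.same {φ ψ ψ' : NodeExpr A} {l l' : List (NodeExpr A)} {k : Key A}
    (h : ValidIdx φ ψ l k) (h' : ValidIdx φ ψ' l' k) :
    (ψ = ψ' ∧ l = l') ∨ qn φ ≤ E (ψ :: l) (ψ' :: l') := by
  cases k with
  | root => exact Or.inr ((le_inf h h').trans (E_seven _ _))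
  | fresh χ =>
    obtain ⟨rfl, rfl, h⟩ := h
    obtain ⟨rfl, rfl, -⟩ := h'
    exact Or.inl ⟨rfl, rfl⟩
  | pair L M =>
    obtain ⟨h, h1⟩ := h
    obtain ⟨-, h2⟩ := h'
    rcases h1 with rfl | rfl <;> rcases h2 with h2 | h2
    · exact Or.inl (List.cons.inj h2)
    · subst h2; exact Or.inr h
    · subst h2; rw [E_comm]; exact Or.inr h
    · exact Or.inl (List.cons.inj h2)

/-- The one-node data tree. -/
def leaf (a : A) : DataTree A where
  X := Unit
  child _ _ := False
  root := ()
  label _ := a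
  eqd _ _ := True
  eqd_equiv := ⟨fun _ => trivial, fun _ => trivial, fun _ _ => trivial⟩
  parent_unique _ _ _ h := h.elim
  root_no_parent _ h := h
  reach _ := .refl
  acyclic x h := by
    obtain ⟨y, -, h⟩ := Relation.TransGen.tail'_iff.1 h
    exact h

theorem good_succ (n : ℕ) (ih : ∀ ψ ∈ (NF A n).2, ∃ T, Good n ψ T)
    (φ : NodeExpr A) (hφ : φ ∈ (NF A (n + 1)).2) : ∃ T, Good (n + 1) φ T := by
  obtain ⟨a, hsem, -, -⟩ := N_spec hφ
  have hne : Nonempty (DataTree A) := ⟨leaf a⟩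
  choose! TT hTT using ih
  have hex : ∀ ψ l, ψ ∈ (NF A n).2 → VL n l → qn ψ ≤ E l l →
      ∃ x, Generic n ψ (TT ψ) l x := fun ψ l h1 h2 h3 => (hTT ψ h1).2 l h2 h3
  let I : Type := {p : NodeExpr A × List (NodeExpr A) × Key A //
    p.1 ∈ (NF A n).2 ∧ VL n p.2.1 ∧ ValidIdx φ p.1 p.2.1 p.2.2}
  let T : I → DataTree A := fun i => TT i.1.1
  let key : I → Key A := fun i => i.1.2.2
  have hpt : ∀ i : I, ∃ x, Generic n i.1.1 (T i) i.1.2.1 x := fun i =>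
    hex _ _ i.2.1 i.2.2.1 (N_live hφ i.2.1 i.2.2.1 i.2.2.2.self)
  choose pt hpt using hpt
  -- the glued tree
  let G : DataTree A := glue T pt key .root a
  have emb : ∀ i, Emb (T i) G (fun x => some (⟨i, x⟩ : Σ i, (T i).X)) := fun i =>
    glue_emb T pt key .root a i
  have hroot : ∀ i : I, nsem (T i) i.1.1 (T i).root := fun i => (hTT _ i.2.1).1
  -- paths from the root
  have path : ∀ ψ l (w : G.X), ψ ∈ (NF A n).2 → psem G (pathOf (ψ :: l)) G.root w →
      ∃ (i : I) (z : (T i).X), i.1.1 = ψ ∧ w = some ⟨i, z⟩ ∧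
        psem (T i) (pathOf l) (T i).root z := by
    intro ψ l w hψ h
    simp only [pathOf, psem] at h
    obtain ⟨y, hy, y', ⟨rfl, hy'⟩, h⟩ := h
    cases hy with
    | root i =>
      obtain ⟨z, rfl, hz⟩ := (emb_p (emb i) _ _ _).1 h
      have := (emb_n (emb i) ψ (T i).root).1 hy'
      exact ⟨i, z, N_unique i.2.1 hψ _ _ (hroot i) this, rfl, hz⟩
  have path' : ∀ (i : I) l z, psem (T i) (pathOf l) (T i).root z →
      psem G (pathOf (i.1.1 :: l)) G.root (some ⟨i, z⟩) := by
    intro i l z h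
    simp only [pathOf, psem]
    exact ⟨some ⟨i, (T i).root⟩, .root i, _, ⟨rfl, (emb_n (emb i) _ _).2 (hroot i)⟩,
      (emb_p (emb i) _ _ _).2 ⟨z, rfl, h⟩⟩
  -- equalities of paths in the glued tree
  have key0 : ∀ ψ l, ψ ∈ (NF A n).2 → VL n l →
      nsem G (.eqTest (pathOf []) (pathOf (ψ :: l))) G.root → qn φ ≤ E [] (ψ :: l) := by
    intro ψ l hψ hl h
    simp only [nsem] at h
    obtain ⟨y, z, hy, hz, e⟩ := h
    obtain rfl : G.root = y := hy
    obtain ⟨i, z, rfl, rfl, hz'⟩ := path ψ l z hψ hz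
    obtain ⟨e1, e2⟩ := gcls_root T pt key .root e
    obtain ⟨m, rfl, hm⟩ := (hpt i).2 l z hl hz' e2
    have hv := i.2.2.2
    change ValidIdx φ i.1.1 i.1.2.1 (key i) at hv
    rw [← e1] at hv
    exact le_trans hv (E_extend [] hm)
  have key1 : ∀ ψ l χ m, ψ ∈ (NF A n).2 → VL n l → χ ∈ (NF A n).2 → VL n m →
      nsem G (.eqTest (pathOf (ψ :: l)) (pathOf (χ :: m))) G.root →
      qn φ ≤ E (ψ :: l) (χ :: m) := by
    intro ψ l χ m hψ hl hχ hm h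
    simp only [nsem] at h
    obtain ⟨y, z, hy, hz, e⟩ := h
    obtain ⟨i, y, rfl, rfl, hy'⟩ := path ψ l y hψ hy
    obtain ⟨j, z, rfl, rfl, hz'⟩ := path χ m z hχ hz
    by_cases hij : i = j
    · subst hij
      have e' := (gcls_same T pt key .root i y z).1 e
      obtain ⟨b, hs, -, -⟩ := N_spec i.2.1
      have hle := (((hs (T i) _).1 (hroot i)).2 l m hl hm).1
        (by simp only [nsem]; exact ⟨y, z, hy', hz', e'⟩)
      exact i.2.2.2.self.trans ((E_head _ _).trans (E_inside hle))
    · obtain ⟨e1, e2, e3⟩ := gcls_ne T pt key .root hij e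
      obtain ⟨m1, rfl, hm1⟩ := (hpt i).2 l y hl hy' e2
      obtain ⟨m2, rfl, hm2⟩ := (hpt j).2 m z hm hz' e3
      have hv := i.2.2.2
      have hv' := j.2.2.2
      change ValidIdx φ i.1.1 i.1.2.1 (key i) at hv
      change ValidIdx φ j.1.1 j.1.2.1 (key j) at hv'
      rw [e1] at hv
      rcases hv.same hv' with ⟨h1, h2⟩ | h1
      · exact absurd (Subtype.ext (Prod.ext h1 (Prod.ext h2 e1))) hij
      · refine (h1.trans (E_extend _ hm2)).trans ?_
        rw [E_comm (i.1.1 :: i.1.2.1), E_comm (i.1.1 :: (i.1.2.1 ++ m1))]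
        exact E_extend _ hm1
  have symm : ∀ l m, nsem G (.eqTest (pathOf l) (pathOf m)) G.root →
      nsem G (.eqTest (pathOf m) (pathOf l)) G.root := by
    intro l m h
    simp only [nsem] at h ⊢
    obtain ⟨y, z, hy, hz, e⟩ := h
    exact ⟨z, y, hz, hy, G.eqd_equiv.symm e⟩
  have key0' : ∀ ψ l, ψ ∈ (NF A n).2 → VL n l → qn φ ≤ E [] (ψ :: l) →
      nsem G (.eqTest (pathOf []) (pathOf (ψ :: l))) G.root := by
    intro ψ l hψ hl h
    let i : I := ⟨(ψ, l, .root), hψ, hl, h⟩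
    simp only [nsem]
    refine ⟨G.root, some ⟨i, pt i⟩, rfl, path' i l (pt i) (hpt i).1, ?_⟩
    exact (gcls_pt T pt key .root i).symm
  have key1' : ∀ ψ l χ m, ψ ∈ (NF A n).2 → VL n l → χ ∈ (NF A n).2 → VL n m →
      qn φ ≤ E (ψ :: l) (χ :: m) →
      nsem G (.eqTest (pathOf (ψ :: l)) (pathOf (χ :: m))) G.root := by
    intro ψ l χ m hψ hl hχ hm h
    let i : I := ⟨(ψ, l, .pair (ψ :: l) (χ :: m)), hψ, hl, h, Or.inl rfl⟩
    let j : I := ⟨(χ, m, .pair (ψ :: l) (χ :: m)), hχ, hm, h, Or.inr rfl⟩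
    simp only [nsem]
    refine ⟨some ⟨i, pt i⟩, some ⟨j, pt j⟩, path' i l (pt i) (hpt i).1,
      path' j m (pt j) (hpt j).1, ?_⟩
    exact (gcls_pt T pt key .root i).trans (gcls_pt T pt key .root j).symm
  have main : ∀ l m, VL (n + 1) l → VL (n + 1) m →
      (nsem G (.eqTest (pathOf l) (pathOf m)) G.root ↔ qn φ ≤ E l m) := by
    rintro (_ | ⟨ψ, l⟩) (_ | ⟨χ, m⟩) hl hm
    · rw [E_nil]
      refine ⟨fun _ => le_top, fun _ => ?_⟩
      simp only [nsem]
      exact ⟨G.root, G.root, rfl, rfl, G.eqd_equiv.refl _⟩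
    · exact ⟨key0 _ _ hm.1 hm.2, key0' _ _ hm.1 hm.2⟩
    · rw [E_comm]
      exact ⟨fun h => key0 _ _ hl.1 hl.2 (symm _ _ h), fun h => symm _ _ (key0' _ _ hl.1 hl.2 h)⟩
    · exact ⟨key1 _ _ _ _ hl.1 hl.2 hm.1 hm.2, key1' _ _ _ _ hl.1 hl.2 hm.1 hm.2⟩
  refine ⟨G, (hsem G G.root).2 ⟨rfl, main⟩, ?_⟩
  rintro (_ | ⟨ψ, l⟩) hl hle
  · refine ⟨G.root, rfl, fun l' y hl' hy e => ⟨l', rfl, ?_⟩⟩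
    refine (main [] l' hl hl').1 ?_
    simp only [nsem]
    exact ⟨G.root, y, rfl, hy, e⟩
  · let i : I := ⟨(ψ, [], .fresh ψ), hl.1, VL_nil n, rfl, rfl, hle.trans (E_head _ _)⟩
    obtain ⟨x, hx1, hx2⟩ := hex ψ l hl.1 hl.2 (N_live hφ hl.1 hl.2 hle)
    refine ⟨some ⟨i, x⟩, path' i l x hx1, ?_⟩
    rintro (_ | ⟨χ, l'⟩) y hl' hy e
    · obtain rfl : G.root = y := hy
      have e1 := (gcls_root T pt key .root (G.eqd_equiv.symm e)).1
      change Key.root = Key.fresh ψ at e1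
      cases e1
    · obtain ⟨j, z, rfl, rfl, hz⟩ := path χ l' y hl'.1 hy
      by_cases hij : i = j
      · subst hij
        have e' := (gcls_same T pt key .root i x z).1 e
        obtain ⟨m, rfl, hm⟩ := hx2 l' z hl'.2 hz e'
        refine ⟨m, rfl, ?_⟩
        rw [List.getLastD_cons]
        exact hm
      · obtain ⟨e1, -, -⟩ := gcls_ne T pt key .root hij e
        have hv := j.2.2.2
        change ValidIdx φ j.1.1 j.1.2.1 (key j) at hv
        rw [← e1] at hv
        obtain ⟨h1, h2, -⟩ := hv
        exact absurd (Subtype.ext (Prod.ext h1 (Prod.ext h2.symm e1))) hij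

theorem good_zero (φ : NodeExpr A) (hφ : φ ∈ (NF A 0).2) : ∃ T, Good 0 φ T := by
  have h := hφ
  simp only [NF, List.mem_map] at h
  obtain ⟨a, -, rfl⟩ := h
  refine ⟨leaf a, ?_, ?_⟩
  · simp only [nsem, psem]
    exact ⟨rfl, (), (), rfl, rfl, trivial⟩
  · rintro (_ | ⟨ψ, l⟩) hl -
    · refine ⟨(), rfl, ?_⟩
      rintro (_ | ⟨χ, l'⟩) y hl' hy e
      · exact ⟨[], rfl, by rw [E_nil]; exact le_top⟩
      · exact hl'.elim
    · exact hl.elim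

theorem good_all (n : ℕ) : ∀ φ ∈ (NF A n).2, ∃ T : DataTree A, Good n φ T := by
  induction n with
  | zero => exact good_zero
  | succ n ih => exact good_succ n ih

end Model
end XPathMinus

/-- Every normal form of level `n` for `XPath↓⁻` is satisfiable at the root
of some data tree. -/
theorem XPathMinus.nf_satisfiable {A : Type} [Fintype A] (hA : 1 < Fintype.card A)
    (n : ℕ) (φ : NodeExpr A) (hφ : φ ∈ Nnf A n) :
    ∃ T : DataTree A, nsem T φ T.root := by
  obtain ⟨T, hT⟩ := good_all n φ hφ
  exact ⟨T, hT.1⟩
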